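/- arXiv:math-ph/0508016 — 7 statements merged into one kernel-verified Lean document; each statement's English description precedes it below -/
import Mathlib

section
/- Let κ ≠ 0 be a real number and let Ω ⊆ {(t,x) ∈ ℝ² : t + x > 0} be open. Let u : ℝ² → ℝ be C³ on Ω and satisfy the Euler–Poisson equation (EP) on Ω. Define Φ(t,x) = (t/κ, −(t+x)^((κ−1)/κ)·(κ(t+x)·u_x(t,x) − u(t,x))) and ũ(t,x) = (t+x)^(−1/κ)·(κ(t+x)·u_x(t,x) + (κ−1)·u(t,x)). Suppose V ⊆ ℝ² is open with Φ(Ω) ⊆ V, the Jacobian determinant of Φ is nonzero at every point of Ω, and U : ℝ² → ℝ is C² on V with U(Φ(t,x)) = ũ(t,x) for all (t,x) ∈ Ω. Then U satisfies the generalized Hunter–Saxton equation at every point of Φ(Ω): for all (t,x) ∈ Ω, writing (t̃,x̃) = Φ(t,x), one has ∂²U/∂t̃∂x̃(t̃,x̃) = U(t̃,x̃)·∂²U/∂x̃²(t̃,x̃) + κ·(∂U/∂x̃(t̃,x̃))². -/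
open Real Set

/-- Partial derivative with respect to the first variable. -/
noncomputable def pdt (f : ℝ × ℝ → ℝ) (p : ℝ × ℝ) : ℝ :=
  deriv (fun s => f (s, p.2)) p.1

/-- Partial derivative with respect to the second variable. -/
noncomputable def pdx (f : ℝ × ℝ → ℝ) (p : ℝ × ℝ) : ℝ :=
  deriv (fun s => f (p.1, s)) p.2

open scoped Topology

lemma hasDerivAt_pdt {f : ℝ × ℝ → ℝ} {p : ℝ × ℝ} (hf : DifferentiableAt ℝ f p) :
    HasDerivAt (fun s => f (s, p.2)) (pdt f p) p.1 := by
  have h : DifferentiableAt ℝ (fun s : ℝ => f (s, p.2)) p.1 :=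
    DifferentiableAt.comp (g := f) (f := fun s : ℝ => (s, p.2)) p.1 hf (by fun_prop)
  exact h.hasDerivAt

lemma hasDerivAt_pdx {f : ℝ × ℝ → ℝ} {p : ℝ × ℝ} (hf : DifferentiableAt ℝ f p) :
    HasDerivAt (fun s => f (p.1, s)) (pdx f p) p.2 := by
  have h : DifferentiableAt ℝ (fun s : ℝ => f (p.1, s)) p.2 :=
    DifferentiableAt.comp (g := f) (f := fun s : ℝ => (p.1, s)) p.2 hf (by fun_prop)
  exact h.hasDerivAt

lemma pdt_eq_fderiv {f : ℝ × ℝ → ℝ} {p : ℝ × ℝ} (hf : DifferentiableAt ℝ f p) :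
    pdt f p = fderiv ℝ f p (1, 0) :=
  (HasFDerivAt.comp_hasDerivAt (l := f) (f := fun s : ℝ => (s, p.2)) p.1 hf.hasFDerivAt
    ((hasDerivAt_id p.1).prodMk (hasDerivAt_const p.1 p.2))).deriv

lemma pdx_eq_fderiv {f : ℝ × ℝ → ℝ} {p : ℝ × ℝ} (hf : DifferentiableAt ℝ f p) :
    pdx f p = fderiv ℝ f p (0, 1) :=
  (HasFDerivAt.comp_hasDerivAt (l := f) (f := fun s : ℝ => (p.1, s)) p.2 hf.hasFDerivAt
    ((hasDerivAt_const p.2 p.1).prodMk (hasDerivAt_id p.2))).deriv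

/-- The chain rule along a plane curve, in terms of partial derivatives. -/
lemma DifferentiableAt.hasDerivAt_comp_curve {f : ℝ × ℝ → ℝ} {g : ℝ → ℝ × ℝ} {s a b : ℝ}
    (hf : DifferentiableAt ℝ f (g s)) (hg₁ : HasDerivAt (fun r => (g r).1) a s)
    (hg₂ : HasDerivAt (fun r => (g r).2) b s) :
    HasDerivAt (fun r => f (g r)) (a * pdt f (g s) + b * pdx f (g s)) s := by
  have h := HasFDerivAt.comp_hasDerivAt (l := f) (f := g) s hf.hasFDerivAt (hg₁.prodMk hg₂)
  have e : ((a, b) : ℝ × ℝ) = a • ((1, 0) : ℝ × ℝ) + b • ((0, 1) : ℝ × ℝ) := by simp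
  rw [e, map_add, map_smul, map_smul, ← pdt_eq_fderiv hf, ← pdx_eq_fderiv hf] at h
  exact h

lemma differentiableAt_pdx {f : ℝ × ℝ → ℝ} {S : Set (ℝ × ℝ)} (hS : IsOpen S)
    (hf : ContDiffOn ℝ 2 f S) {p : ℝ × ℝ} (hp : p ∈ S) : DifferentiableAt ℝ (pdx f) p := by
  have h : ContDiffOn ℝ 1 (fderiv ℝ f) S := hf.fderiv_of_isOpen hS (by norm_num)
  have h1 : DifferentiableAt ℝ (fun q => fderiv ℝ f q (0, 1)) p :=
    ((h.differentiableOn (by norm_num)).differentiableAt (hS.mem_nhds hp)).clm_apply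
      (differentiableAt_const _)
  refine h1.congr_of_eventuallyEq ?_
  filter_upwards [hS.mem_nhds hp] with q hq
  exact pdx_eq_fderiv ((hf.differentiableOn (by norm_num)).differentiableAt (hS.mem_nhds hq))

lemma eventually_mem_slice_fst {S : Set (ℝ × ℝ)} (hS : IsOpen S) {p : ℝ × ℝ} (hp : p ∈ S) :
    ∀ᶠ s in 𝓝 p.1, (s, p.2) ∈ S :=
  (by fun_prop : Continuous fun s : ℝ => (s, p.2)).continuousAt.eventually_mem (hS.mem_nhds hp)

lemma eventually_mem_slice_snd {S : Set (ℝ × ℝ)} (hS : IsOpen S) {p : ℝ × ℝ} (hp : p ∈ S) :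
    ∀ᶠ s in 𝓝 p.2, (p.1, s) ∈ S :=
  (by fun_prop : Continuous fun s : ℝ => (p.1, s)).continuousAt.eventually_mem (hS.mem_nhds hp)

/-- Derivative of the product of a power `σ ^ c` with a combination `κ * σ * v + d * w`, where
`σ` has unit speed. -/
lemma hasDerivAt_rpow_mul_combination {κ c d s v' w' : ℝ} {σ v w : ℝ → ℝ}
    (hσ : HasDerivAt σ 1 s) (hpos : 0 < σ s) (hv : HasDerivAt v v' s) (hw : HasDerivAt w w' s) :
    HasDerivAt (fun r => σ r ^ c * (κ * σ r * v r + d * w r))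
      (σ s ^ c * (c / σ s * (κ * σ s * v s + d * w s) + κ * v s + κ * σ s * v' + d * w')) s := by
  have h1 := hσ.rpow_const (p := c) (Or.inl hpos.ne')
  have h2 := h1.mul (((hσ.const_mul κ).mul hv).add (hw.const_mul d))
  refine h2.congr_deriv ?_
  simp only [Pi.mul_apply, Pi.add_apply]
  rw [rpow_sub_one hpos.ne']
  field_simp
  ring

/-- On solutions of the Euler–Poisson equation, the `t`-derivative of the second component of the
transformation is `-W / κ`, where `W` is the transformed unknown. -/
lemma rpow_transform_t_identity {κ s a b c e : ℝ} (hκ : κ ≠ 0) (hs : 0 < s)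
    (he : e = c / (κ * s) + 2 * (1 - κ) * a / (κ * s) - 2 * (1 - κ) * b / (κ * s) ^ 2) :
    -(s ^ ((κ - 1) / κ) * ((κ - 1) / κ / s * (κ * s * a + -1 * b) + κ * a + κ * s * e + -1 * c))
      = -(s ^ (-1 / κ) * (κ * s * a + (κ - 1) * b)) / κ := by
  have hpow : s ^ ((κ - 1) / κ) = s * s ^ (-1 / κ) := by
    rw [show (κ - 1) / κ = 1 + -1 / κ by field_simp; ring, rpow_add hs, rpow_one]
  rw [hpow, he]
  field_simp
  ring

/-- The `x`-derivative of the second component of the transformation is `-(t + x)` times the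
`x`-derivative of the transformed unknown. -/
lemma rpow_transform_x_identity {κ s a b a' : ℝ} (hκ : κ ≠ 0) (hs : 0 < s) :
    -(s ^ ((κ - 1) / κ) * ((κ - 1) / κ / s * (κ * s * a + -1 * b) + κ * a + κ * s * a' + -1 * a))
      = -s * (s ^ (-1 / κ) *
        (-1 / κ / s * (κ * s * a + (κ - 1) * b) + κ * a + κ * s * a' + (κ - 1) * a)) := by
  have hpow : s ^ ((κ - 1) / κ) = s * s ^ (-1 / κ) := by
    rw [show (κ - 1) / κ = 1 + -1 / κ by field_simp; ring, rpow_add hs, rpow_one]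
  rw [hpow]
  field_simp
  ring

/-- The contact transformation Φ takes solutions of the Euler–Poisson equation to
solutions of the generalized Hunter–Saxton equation. -/
theorem euler_poisson_to_hunter_saxton
    (κ : ℝ) (hκ : κ ≠ 0)
    (Ω : Set (ℝ × ℝ)) (hΩopen : IsOpen Ω)
    (hΩpos : ∀ p ∈ Ω, 0 < p.1 + p.2)
    (u : ℝ × ℝ → ℝ) (hu : ContDiffOn ℝ 3 u Ω)
    (hEP : ∀ p ∈ Ω, pdt (pdx u) p =
      pdt u p / (κ * (p.1 + p.2))
      + 2 * (1 - κ) * pdx u p / (κ * (p.1 + p.2))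
      - 2 * (1 - κ) * u p / (κ * (p.1 + p.2)) ^ 2)
    (Φ : ℝ × ℝ → ℝ × ℝ)
    (hΦ : ∀ p : ℝ × ℝ, Φ p = (p.1 / κ,
      -(p.1 + p.2) ^ ((κ - 1) / κ) * (κ * (p.1 + p.2) * pdx u p - u p)))
    (V : Set (ℝ × ℝ)) (hVopen : IsOpen V) (hΦV : Φ '' Ω ⊆ V)
    (hJac : ∀ p ∈ Ω,
      pdt (fun q => (Φ q).1) p * pdx (fun q => (Φ q).2) p
      - pdx (fun q => (Φ q).1) p * pdt (fun q => (Φ q).2) p ≠ 0)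
    (U : ℝ × ℝ → ℝ) (hU : ContDiffOn ℝ 2 U V)
    (hUΦ : ∀ p ∈ Ω, U (Φ p) =
      (p.1 + p.2) ^ (-1 / κ) * (κ * (p.1 + p.2) * pdx u p + (κ - 1) * u p)) :
    ∀ p ∈ Ω,
      pdt (pdx U) (Φ p) = U (Φ p) * pdx (pdx U) (Φ p) + κ * pdx U (Φ p) ^ 2 := by
  have hUD : ∀ p ∈ Ω, DifferentiableAt ℝ U (Φ p) := fun p hp =>
    (hU.differentiableOn (by norm_num)).differentiableAt
      (hVopen.mem_nhds (hΦV (mem_image_of_mem Φ hp)))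
  have hΦ₁t : ∀ p : ℝ × ℝ, HasDerivAt (fun r => (Φ (r, p.2)).1) (1 / κ) p.1 := fun p => by
    simp only [hΦ]
    exact (hasDerivAt_id p.1).div_const κ
  have hΦ₁x : ∀ p : ℝ × ℝ, HasDerivAt (fun r => (Φ (p.1, r)).1) 0 p.2 := fun p => by
    simpa only [hΦ] using hasDerivAt_const p.2 (p.1 / κ)
  have hΦ₂ : ∀ q, (Φ q).2 =
      -((q.1 + q.2) ^ ((κ - 1) / κ) * (κ * (q.1 + q.2) * pdx u q + -1 * u q)) := fun q => by
    rw [hΦ]; ring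
  have huD : ∀ p ∈ Ω, DifferentiableAt ℝ u p := fun p hp =>
    (hu.differentiableOn (by norm_num)).differentiableAt (hΩopen.mem_nhds hp)
  have huxD : ∀ p ∈ Ω, DifferentiableAt ℝ (pdx u) p := fun p hp =>
    differentiableAt_pdx hΩopen (hu.of_le (by norm_num)) hp
  have hσt : ∀ p : ℝ × ℝ, HasDerivAt (fun r => r + p.2) 1 p.1 := fun p =>
    (hasDerivAt_id p.1).add_const p.2
  have hσx : ∀ p : ℝ × ℝ, HasDerivAt (fun r => p.1 + r) 1 p.2 := fun p =>
    (hasDerivAt_id p.2).const_add p.1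
  have hΦ₂t : ∀ p ∈ Ω, HasDerivAt (fun r => (Φ (r, p.2)).2) (-U (Φ p) / κ) p.1 := fun p hp => by
    simp only [hΦ₂]
    rw [hUΦ p hp, ← rpow_transform_t_identity hκ (hΩpos p hp) (hEP p hp)]
    exact (hasDerivAt_rpow_mul_combination (hσt p) (hΩpos p hp)
      (hasDerivAt_pdt (huxD p hp)) (hasDerivAt_pdt (huD p hp))).neg
  have hWx : ∀ p ∈ Ω, ∃ w, HasDerivAt (fun r => U (Φ (p.1, r))) w p.2 ∧
      HasDerivAt (fun r => (Φ (p.1, r)).2) (-(p.1 + p.2) * w) p.2 := fun p hp => by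
    refine ⟨_, (hasDerivAt_rpow_mul_combination (c := -1 / κ) (κ := κ) (d := κ - 1) (hσx p)
      (hΩpos p hp) (hasDerivAt_pdx (huxD p hp))
      (hasDerivAt_pdx (huD p hp))).congr_of_eventuallyEq ?_, ?_⟩
    · filter_upwards [eventually_mem_slice_snd hΩopen hp] with r hr using hUΦ _ hr
    · simp only [hΦ₂]
      rw [← rpow_transform_x_identity hκ (hΩpos p hp)]
      exact (hasDerivAt_rpow_mul_combination (hσx p) (hΩpos p hp)
        (hasDerivAt_pdx (huxD p hp)) (hasDerivAt_pdx (huD p hp))).neg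
  have hX : ∀ p ∈ Ω, ∀ w, HasDerivAt (fun r => (Φ (p.1, r)).2) w p.2 → w ≠ 0 := by
    rintro p hp w hw rfl
    apply hJac p hp
    simp only [pdx, hw.deriv, (hΦ₁x p).deriv]
    ring
  have hUX : ∀ p ∈ Ω, pdx U (Φ p) = -(p.1 + p.2)⁻¹ := fun p hp => by
    obtain ⟨w, hw, hw'⟩ := hWx p hp
    have hne := hX p hp _ hw'
    have hs := (hΩpos p hp).ne'
    have h := hw.unique ((hUD p hp).hasDerivAt_comp_curve (g := fun r => Φ (p.1, r))
      (hΦ₁x p) hw')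
    have hw0 : w ≠ 0 := right_ne_zero_of_mul hne
    simp only [Prod.mk.eta, zero_mul, zero_add] at h
    have h' : w * (1 + (p.1 + p.2) * pdx U (Φ p)) = 0 := by linear_combination h
    have h'' := (mul_eq_zero.mp h').resolve_left hw0
    field_simp
    linear_combination h''
  intro p hp
  have hs := (hΩpos p hp).ne'
  have hUxD : DifferentiableAt ℝ (pdx U) (Φ p) :=
    differentiableAt_pdx hVopen hU (hΦV (mem_image_of_mem Φ hp))
  have ht := (hUxD.hasDerivAt_comp_curve (g := fun r => Φ (r, p.2)) (hΦ₁t p)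
    (hΦ₂t p hp)).unique (((hσt p).inv hs).neg.congr_of_eventuallyEq (by
      filter_upwards [eventually_mem_slice_fst hΩopen hp] with r hr using hUX _ hr))
  simp only [Prod.mk.eta] at ht
  rw [hUX p hp]
  field_simp at ht ⊢
  linear_combination ht
end

section
/- Let κ ≠ 0 be a real number, let I, J ⊆ ℝ be open intervals with t + x > 0 for all t ∈ I, x ∈ J, and fix x₀ ∈ J. Let S : ℝ → ℝ be C² on I and R : ℝ → ℝ be C¹ on J. Define F(t,x) = ∫_{x₀}^{x} R(s)·(t+s)^(1/κ) ds and v(t,x) = (t+x)^((1−2κ)/κ)·(S(t) + F(t,x)). Then v satisfies the transformed equation (EP') at every point of I × J: v_{tx} = (1−2κ)·v_t/(κ(t+x)) + 2(1−κ)·v_x/(κ(t+x)) − (2κ−1)(κ−2)·v/(κ(t+x))². -/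
open Real Set

/-- Differentiation under the integral sign for a power kernel on a compact interval. -/
theorem hasDerivAt_integral_mul_add_rpow {R : ℝ → ℝ} {a b t : ℝ} (c : ℝ)
    (hR : ContinuousOn R (uIcc a b)) (ht : ∀ s ∈ uIcc a b, 0 < t + s) :
    HasDerivAt (fun τ => ∫ s in a..b, R s * (τ + s) ^ c)
      (∫ s in a..b, R s * (c * (t + s) ^ (c - 1))) t := by
  obtain ⟨m, hm, hle⟩ : ∃ m, 0 < t + m ∧ ∀ s ∈ uIcc a b, m ≤ s :=
    ⟨min a b, ht _ (left_mem_Icc.2 min_le_max), fun s hs => hs.1⟩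
  set δ := (t + m) / 2 with hδ
  have hδ0 : 0 < δ := by positivity
  have hp : ∀ τ ∈ Icc (t - δ) (t + δ), ∀ s ∈ uIcc a b, 0 < τ + s := by
    intro τ hτ s hs
    linarith [hτ.1, hle s hs]
  have hcont : ∀ τ ∈ Icc (t - δ) (t + δ), ∀ e : ℝ,
      ContinuousOn (fun s => (τ + s) ^ e) (uIcc a b) := fun τ hτ e =>
    ContinuousOn.rpow_const (by fun_prop) fun s hs => Or.inl (hp τ hτ s hs).ne'
  have hnhds : Icc (t - δ) (t + δ) ∈ nhds t := Icc_mem_nhds (by linarith) (by linarith)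
  have htmem : t ∈ Icc (t - δ) (t + δ) := mem_of_mem_nhds hnhds
  have hmeas : ∀ f : ℝ → ℝ, ContinuousOn f (uIcc a b) →
      MeasureTheory.AEStronglyMeasurable f (MeasureTheory.volume.restrict (uIoc a b)) :=
    fun f hf => (hf.mono uIoc_subset_uIcc).aestronglyMeasurable measurableSet_uIoc
  have hbdd : ContinuousOn (fun q : ℝ × ℝ => R q.2 * (c * (q.1 + q.2) ^ (c - 1)))
      (Icc (t - δ) (t + δ) ×ˢ uIcc a b) := by
    refine (hR.comp continuousOn_snd fun q hq => hq.2).mul (continuousOn_const.mul ?_)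
    exact ContinuousOn.rpow_const (by fun_prop) fun q hq => Or.inl (hp _ hq.1 _ hq.2).ne'
  obtain ⟨C, hC⟩ := (isCompact_Icc.prod isCompact_uIcc).exists_bound_of_continuousOn hbdd
  refine (intervalIntegral.hasDerivAt_integral_of_dominated_loc_of_deriv_le
    (F' := fun τ s => R s * (c * (τ + s) ^ (c - 1))) (bound := fun _ => C) hnhds
    ?_ ?_ ?_ ?_ intervalIntegrable_const ?_).2
  · filter_upwards [hnhds] with τ hτ
    exact hmeas _ (hR.mul (hcont τ hτ c))
  · exact (hR.mul (hcont t htmem c)).intervalIntegrable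
  · exact hmeas _ (hR.mul (continuousOn_const.mul (hcont t htmem (c - 1))))
  · exact .of_forall fun s hs τ hτ => hC (τ, s) ⟨hτ, uIoc_subset_uIcc hs⟩
  · refine .of_forall fun s hs τ hτ => HasDerivAt.const_mul _ ?_
    simpa using ((hasDerivAt_id τ).add_const s).rpow_const (p := c)
      (Or.inl (hp τ hτ s (uIoc_subset_uIcc hs)).ne')

/-- The explicit formula v = (t+x)^((1-2κ)/κ)(S(t) + ∫ R(s)(t+s)^(1/κ) ds) defines
a solution of the transformed equation (EP'). -/
theorem general_solution_of_transformed_equation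
    (κ : ℝ) (hκ : κ ≠ 0)
    (I J : Set ℝ) (hIopen : IsOpen I) (hIconn : I.OrdConnected)
    (hJopen : IsOpen J) (hJconn : J.OrdConnected)
    (hpos : ∀ t ∈ I, ∀ x ∈ J, 0 < t + x)
    (x₀ : ℝ) (hx₀ : x₀ ∈ J)
    (S R : ℝ → ℝ) (hS : ContDiffOn ℝ 2 S I) (hR : ContDiffOn ℝ 1 R J)
    (v : ℝ × ℝ → ℝ)
    (hv : ∀ p : ℝ × ℝ, v p = (p.1 + p.2) ^ ((1 - 2 * κ) / κ) *
      (S p.1 + ∫ s in x₀..p.2, R s * (p.1 + s) ^ (1 / κ))) :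
    ∀ p ∈ I ×ˢ J,
      pdt (pdx v) p =
        (1 - 2 * κ) * pdt v p / (κ * (p.1 + p.2))
        + 2 * (1 - κ) * pdx v p / (κ * (p.1 + p.2))
        - (2 * κ - 1) * (κ - 2) * v p / (κ * (p.1 + p.2)) ^ 2 := by
  rintro ⟨t, x⟩ ⟨ht, hx⟩
  dsimp only at ht hx ⊢
  set a := (1 - 2 * κ) / κ with ha
  set b := 1 / κ with hb
  set W : ℝ → ℝ → ℝ := fun τ ξ => S τ + ∫ s in x₀..ξ, R s * (τ + s) ^ b with hW
  have hvW : ∀ τ ξ, v (τ, ξ) = (τ + ξ) ^ a * W τ ξ := fun τ ξ => hv (τ, ξ)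
  have hsub : uIcc x₀ x ⊆ J := hJconn.uIcc_subset hx₀ hx
  have hpow : ∀ e τ ξ : ℝ, 0 < τ + ξ →
      HasDerivAt (fun τ => (τ + ξ) ^ e) (e * (τ + ξ) ^ (e - 1)) τ := fun e τ ξ h => by
    simpa using ((hasDerivAt_id τ).add_const ξ).rpow_const (p := e) (Or.inl h.ne')
  have hy : 0 < t + x := hpos t ht x hx
  obtain ⟨Wt, hWt⟩ : ∃ w, HasDerivAt (fun τ => W τ x) w t :=
    ⟨_, ((hS.differentiableOn (by norm_num)).differentiableAt
      (hIopen.mem_nhds ht)).hasDerivAt.add (hasDerivAt_integral_mul_add_rpow b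
        (hR.continuousOn.mono hsub) fun s hs => hpos t ht s (hsub hs))⟩
  have hWx : ∀ τ ∈ I, HasDerivAt (fun ξ => W τ ξ) (R x * (τ + x) ^ b) x := by
    intro τ hτ
    have hc : ContinuousOn (fun s => R s * (τ + s) ^ b) J :=
      hR.continuousOn.mul (ContinuousOn.rpow_const (by fun_prop)
        fun s hs => Or.inl (hpos τ hτ s hs).ne')
    exact (intervalIntegral.integral_hasDerivAt_right (hc.mono hsub).intervalIntegrable
      (hc.stronglyMeasurableAtFilter hJopen x hx)
      (hc.continuousAt (hJopen.mem_nhds hx))).const_add (S τ)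
  have hpdx : ∀ τ ∈ I, pdx v (τ, x) =
      a * (τ + x) ^ (a - 1) * W τ x + (τ + x) ^ a * (R x * (τ + x) ^ b) := by
    intro τ hτ
    have h := hpow a x τ (by linarith [hpos τ hτ x hx])
    simp only [add_comm _ τ] at h
    simp only [pdx, hvW]
    exact (h.mul (hWx τ hτ)).deriv
  have hpdt : pdt v (t, x) = a * (t + x) ^ (a - 1) * W t x + (t + x) ^ a * Wt := by
    simp only [pdt, hvW]
    exact ((hpow a t x hy).mul hWt).deriv
  have hpdtx : pdt (pdx v) (t, x) =
      (a * ((a - 1) * (t + x) ^ (a - 1 - 1))) * W t x + a * (t + x) ^ (a - 1) * Wt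
      + (a * (t + x) ^ (a - 1) * (R x * (t + x) ^ b)
        + (t + x) ^ a * (R x * (b * (t + x) ^ (b - 1)))) := by
    have heq : (fun τ => pdx v (τ, x)) =ᶠ[nhds t] fun τ =>
        a * (τ + x) ^ (a - 1) * W τ x + (τ + x) ^ a * (R x * (τ + x) ^ b) := by
      filter_upwards [hIopen.mem_nhds ht] with τ hτ using hpdx τ hτ
    simp only [pdt]
    rw [heq.deriv_eq]
    exact ((((hpow (a - 1) t x hy).const_mul a).mul hWt).add
      ((hpow a t x hy).mul ((hpow b t x hy).const_mul (R x)))).deriv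
  rw [hpdtx, hpdt, hpdx t ht, hvW]
  have hab : a = b - 2 := by rw [ha, hb]; field_simp
  have hκb : κ = 1 / b := by rw [hb]; field_simp
  have hb0 : b ≠ 0 := by rw [hb]; positivity
  clear_value a b W
  subst hab hκb
  simp only [rpow_sub_one hy.ne']
  field_simp
  ring
end

section
/- Let κ ≠ 0 be a real number, let I, J ⊆ ℝ be open intervals with t + x > 0 for all t ∈ I, x ∈ J, and fix x₀ ∈ J. Let S : ℝ → ℝ be C³ on I and R : ℝ → ℝ be C¹ on J. Define F(t,x) = ∫_{x₀}^{x} R(s)·(t+s)^(1/κ) ds, G(t,x) = ∫_{x₀}^{x} R(s)·(t+s)^((1−κ)/κ) ds, and u(t,x) = (t+x)^(1/κ)·(κ·S′(t) + G(t,x)) − (t+x)^((1−κ)/κ)·(S(t) + F(t,x)). Then u satisfies the Euler–Poisson equation (EP) at every point of I × J: u_{tx} = u_t/(κ(t+x)) + 2(1−κ)·u_x/(κ(t+x)) − 2(1−κ)·u/(κ(t+x))². -/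
open Real Set

open MeasureTheory Topology

/-- Differentiation under the integral sign over a compact interval, for a jointly continuous
partial derivative. -/
theorem hasDerivAt_intervalIntegral_of_continuousOn {f f' : ℝ → ℝ → ℝ} {U : Set ℝ} {a b t : ℝ}
    (hU : IsOpen U) (ht : t ∈ U) (hf : ∀ τ ∈ U, ContinuousOn (f τ) (uIcc a b))
    (hf' : ContinuousOn (fun q : ℝ × ℝ => f' q.1 q.2) (U ×ˢ uIcc a b))
    (hderiv : ∀ τ ∈ U, ∀ s ∈ uIcc a b, HasDerivAt (fun r => f r s) (f' τ s) τ) :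
    HasDerivAt (fun τ => ∫ s in a..b, f τ s) (∫ s in a..b, f' t s) t := by
  obtain ⟨K, hK, htK, hKU⟩ := exists_compact_subset hU ht
  obtain ⟨C, hC⟩ := (hK.prod isCompact_uIcc).exists_bound_of_continuousOn
    (hf'.mono (prod_mono hKU Subset.rfl))
  have meas {g : ℝ → ℝ} (hg : ContinuousOn g (uIcc a b)) :
      AEStronglyMeasurable g (volume.restrict (uIoc a b)) :=
    (hg.mono uIoc_subset_uIcc).aestronglyMeasurable measurableSet_uIoc
  refine (intervalIntegral.hasDerivAt_integral_of_dominated_loc_of_deriv_le (s := K) (F' := f')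
    (bound := fun _ => C) (mem_interior_iff_mem_nhds.mp htK) ?_ (hf t ht).intervalIntegrable
    (meas ?_) ?_ intervalIntegrable_const ?_).2
  · filter_upwards [hU.mem_nhds ht] with τ hτ using meas (hf τ hτ)
  · exact hf'.comp (f := fun s => (t, s)) (by fun_prop) fun s hs => ⟨ht, hs⟩
  · exact .of_forall fun s hs τ hτ => hC (τ, s) ⟨hτ, uIoc_subset_uIcc hs⟩
  · exact .of_forall fun s hs τ hτ => hderiv τ (hKU hτ) s (uIoc_subset_uIcc hs)

section ShiftedPower

variable {I J : Set ℝ} {R : ℝ → ℝ} {x₀ t x : ℝ}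

theorem hasDerivAt_add_const_rpow (c : ℝ) (h : 0 < t + x) :
    HasDerivAt (fun τ => (τ + x) ^ c) (c * (t + x) ^ (c - 1)) t := by
  simpa using ((hasDerivAt_id t).add_const x).rpow_const (p := c) (.inl h.ne')

theorem hasDerivAt_const_add_rpow (c : ℝ) (h : 0 < t + x) :
    HasDerivAt (fun ξ => (t + ξ) ^ c) (c * (t + x) ^ (c - 1)) x := by
  simpa using ((hasDerivAt_id x).const_add t).rpow_const (p := c) (.inl h.ne')

theorem continuousOn_mul_add_rpow (hR : ContinuousOn R J) (hpos : ∀ s ∈ J, 0 < t + s) (c : ℝ) :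
    ContinuousOn (fun s => R s * (t + s) ^ c) J :=
  hR.mul ((continuousOn_const.add continuousOn_id).rpow_const fun s hs => .inl (hpos s hs).ne')

theorem hasDerivAt_integral_mul_add_rpow_param (hI : IsOpen I) (hJ : J.OrdConnected)
    (hpos : ∀ t ∈ I, ∀ x ∈ J, 0 < t + x) (hR : ContinuousOn R J) (hx₀ : x₀ ∈ J) (ht : t ∈ I)
    (hx : x ∈ J) (c : ℝ) :
    HasDerivAt (fun τ => ∫ s in x₀..x, R s * (τ + s) ^ c)
      (c * ∫ s in x₀..x, R s * (t + s) ^ (c - 1)) t := by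
  have hsub : uIcc x₀ x ⊆ J := hJ.uIcc_subset hx₀ hx
  rw [← intervalIntegral.integral_const_mul]
  refine hasDerivAt_intervalIntegral_of_continuousOn (f := fun τ s => R s * (τ + s) ^ c)
    (f' := fun τ s => c * (R s * (τ + s) ^ (c - 1))) hI ht
    (fun τ hτ => (continuousOn_mul_add_rpow hR (hpos τ hτ) c).mono hsub) ?_ ?_
  · refine continuousOn_const.mul ((hR.comp continuousOn_snd fun q hq => hsub hq.2).mul ?_)
    exact (continuousOn_fst.add continuousOn_snd).rpow_const
      fun q hq => .inl (hpos _ hq.1 _ (hsub hq.2)).ne'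
  · intro τ hτ s hs
    exact ((hasDerivAt_add_const_rpow c (hpos τ hτ s (hsub hs))).const_mul (R s)).congr_deriv
      (mul_left_comm _ _ _)

theorem hasDerivAt_integral_mul_add_rpow_endpoint (hJo : IsOpen J) (hJ : J.OrdConnected)
    (hpos : ∀ s ∈ J, 0 < t + s) (hR : ContinuousOn R J) (hx₀ : x₀ ∈ J) (hx : x ∈ J) (c : ℝ) :
    HasDerivAt (fun ξ => ∫ s in x₀..ξ, R s * (t + s) ^ c) (R x * (t + x) ^ c) x := by
  have hc := continuousOn_mul_add_rpow hR hpos c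
  exact intervalIntegral.integral_hasDerivAt_right
    (hc.mono (hJ.uIcc_subset hx₀ hx)).intervalIntegrable
    (hc.stronglyMeasurableAtFilter hJo x hx) (hc.continuousAt (hJo.mem_nhds hx))

end ShiftedPower

/-- The explicit formula
u = (t+x)^(1/κ)(κS'(t) + G(t,x)) - (t+x)^((1-κ)/κ)(S(t) + F(t,x)) defines a solution
of the Euler–Poisson equation (EP). -/
theorem general_solution_of_euler_poisson
    (κ : ℝ) (hκ : κ ≠ 0)
    (I J : Set ℝ) (hIopen : IsOpen I) (hIconn : I.OrdConnected)
    (hJopen : IsOpen J) (hJconn : J.OrdConnected)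
    (hpos : ∀ t ∈ I, ∀ x ∈ J, 0 < t + x)
    (x₀ : ℝ) (hx₀ : x₀ ∈ J)
    (S R : ℝ → ℝ) (hS : ContDiffOn ℝ 3 S I) (hR : ContDiffOn ℝ 1 R J)
    (F G : ℝ × ℝ → ℝ)
    (hF : ∀ p : ℝ × ℝ, F p = ∫ s in x₀..p.2, R s * (p.1 + s) ^ (1 / κ))
    (hG : ∀ p : ℝ × ℝ, G p = ∫ s in x₀..p.2, R s * (p.1 + s) ^ ((1 - κ) / κ))
    (u : ℝ × ℝ → ℝ)
    (hu : ∀ p : ℝ × ℝ, u p =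
      (p.1 + p.2) ^ (1 / κ) * (κ * deriv S p.1 + G p)
      - (p.1 + p.2) ^ ((1 - κ) / κ) * (S p.1 + F p)) :
    ∀ p ∈ I ×ˢ J,
      pdt (pdx u) p =
        pdt u p / (κ * (p.1 + p.2))
        + 2 * (1 - κ) * pdx u p / (κ * (p.1 + p.2))
        - 2 * (1 - κ) * u p / (κ * (p.1 + p.2)) ^ 2 := by
  rintro ⟨t, x⟩ ⟨ht, hx⟩
  dsimp only at ht hx
  obtain ⟨a, ha⟩ : ∃ a, a = 1 / κ := ⟨_, rfl⟩
  have hexp : (1 - κ) / κ = a - 1 := by rw [ha]; field_simp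
  simp only [hexp, ← ha] at hF hG hu
  have hRc := hR.continuousOn
  have hS_deriv {τ : ℝ} (hτ : τ ∈ I) : HasDerivAt S (deriv S τ) τ :=
    ((hS.differentiableOn (by norm_num)).differentiableAt (hIopen.mem_nhds hτ)).hasDerivAt
  have hS_deriv₂ {τ : ℝ} (hτ : τ ∈ I) : HasDerivAt (deriv S) (deriv (deriv S) τ) τ :=
    ((((contDiffOn_succ_iff_deriv_of_isOpen (n := 2) hIopen).mp hS).2.2.differentiableOn
      (by norm_num)).differentiableAt (hIopen.mem_nhds hτ)).hasDerivAt
  have hF_t {τ : ℝ} (hτ : τ ∈ I) : HasDerivAt (fun r => F (r, x)) (a * G (τ, x)) τ := by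
    simpa only [hF, hG] using
      hasDerivAt_integral_mul_add_rpow_param hIopen hJconn hpos hRc hx₀ hτ hx a
  obtain ⟨H, hG_t⟩ : ∃ H, HasDerivAt (fun r => G (r, x)) ((a - 1) * H) t := by
    simp only [hG]
    exact ⟨_, hasDerivAt_integral_mul_add_rpow_param hIopen hJconn hpos hRc hx₀ ht hx (a - 1)⟩
  have hF_x {τ : ℝ} (hτ : τ ∈ I) :
      HasDerivAt (fun ξ => F (τ, ξ)) (R x * (τ + x) ^ a) x := by
    simpa only [hF] using
      hasDerivAt_integral_mul_add_rpow_endpoint hJopen hJconn (hpos τ hτ) hRc hx₀ hx a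
  have hG_x {τ : ℝ} (hτ : τ ∈ I) :
      HasDerivAt (fun ξ => G (τ, ξ)) (R x * (τ + x) ^ (a - 1)) x := by
    simpa only [hG] using
      hasDerivAt_integral_mul_add_rpow_endpoint hJopen hJconn (hpos τ hτ) hRc hx₀ hx (a - 1)
  have hu_x {τ : ℝ} (hτ : τ ∈ I) : pdx u (τ, x) =
      a * ((τ + x) ^ (a - 1) * (κ * deriv S τ + G (τ, x)))
        - (a - 1) * ((τ + x) ^ (a - 1 - 1) * (S τ + F (τ, x))) := by
    have hy := hpos τ hτ x hx
    simp only [pdx, hu]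
    refine (((hasDerivAt_const_add_rpow a hy).mul ((hG_x hτ).const_add (κ * deriv S τ))).sub
      ((hasDerivAt_const_add_rpow (a - 1) hy).mul ((hF_x hτ).const_add (S τ)))).deriv.trans ?_
    ring
  have hy := hpos t ht x hx
  have hu_t := ((hasDerivAt_add_const_rpow a hy).mul
      (((hS_deriv₂ ht).const_mul κ).add hG_t)).sub
    ((hasDerivAt_add_const_rpow (a - 1) hy).mul ((hS_deriv ht).add (hF_t ht)))
  have hu_xt := (((hasDerivAt_add_const_rpow (a - 1) hy).mul
      (((hS_deriv₂ ht).const_mul κ).add hG_t)).const_mul a).sub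
    (((hasDerivAt_add_const_rpow (a - 1 - 1) hy).mul
      ((hS_deriv ht).add (hF_t ht))).const_mul (a - 1))
  have ht_eq : pdt u (t, x) = _ :=
    (hu_t.congr_of_eventuallyEq (.of_forall fun τ => hu (τ, x))).deriv
  have hu_x_near : ∀ᶠ τ in 𝓝 t, pdx u (τ, x) = _ :=
    (hIopen.eventually_mem ht).mono fun τ hτ => hu_x hτ
  have hxt_eq : pdt (pdx u) (t, x) = _ := (hu_xt.congr_of_eventuallyEq hu_x_near).deriv
  rw [hxt_eq, ht_eq, hu_x ht, hu]
  simp only [Pi.add_apply]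
  have hpow (c : ℝ) : (t + x) ^ c = (t + x) ^ (c - 1) * (t + x) := by
    rw [← Real.rpow_add_one hy.ne', sub_add_cancel]
  rw [hpow a, hpow (a - 1), hpow (a - 1 - 1)]
  have hy0 := hy.ne'
  generalize (t + x) ^ (a - 1 - 1 - 1) = P
  generalize t + x = y at *
  obtain rfl : a = κ⁻¹ := by rw [ha, one_div]
  field_simp
  ring
end

section
/- Let P₀, Q₀ be real numbers with Q₀ ≠ 0, and on the region t + x > 0 define T(t,x) = 2/(Q₀(t+x)), X(t,x) = 2P₀/(Q₀(t+x)), U(t,x) = −4P₀/(Q₀²(t+x)²) (the coefficients of the Euler–Poisson equation u_{tx} = T u_t + X u_x + U u). Then the Laplace semi-invariants satisfy H(t,x) := −T_t(t,x) + T(t,x)·X(t,x) + U(t,x) = 2/(Q₀(t+x)²) and K(t,x) := −X_x(t,x) + T(t,x)·X(t,x) + U(t,x) = P₀·H(t,x); moreover ∂²(log|H|)/∂t∂x (t,x) = Q₀·H(t,x). Consequently the Ovsiannikov invariants are constant: K/H ≡ P₀ and ((log|H|)_{tx})/H ≡ Q₀. -/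
open Real Set

/-- On `t + x > 0`, the `t`-derivative of a function of `t + x` is its ordinary derivative. -/
theorem pdt_eq_of_hasDerivAt_add {f : ℝ × ℝ → ℝ} {g : ℝ → ℝ} {g' : ℝ} {p : ℝ × ℝ}
    (hf : ∀ q : ℝ × ℝ, 0 < q.1 + q.2 → f q = g (q.1 + q.2)) (hp : 0 < p.1 + p.2)
    (hg : HasDerivAt g g' (p.1 + p.2)) : pdt f p = g' := by
  have hev : (fun s => f (s, p.2)) =ᶠ[nhds p.1] fun s => g (s + p.2) := by
    have hpos : ∀ᶠ s in nhds p.1, 0 < s + p.2 :=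
      (continuous_id.add continuous_const).continuousAt.eventually (lt_mem_nhds hp)
    filter_upwards [hpos] with s hs using hf (s, p.2) hs
  exact ((hg.comp_add_const p.1 p.2).congr_of_eventuallyEq hev).deriv

/-- On `t + x > 0`, the `x`-derivative of a function of `t + x` is its ordinary derivative. -/
theorem pdx_eq_of_hasDerivAt_add {f : ℝ × ℝ → ℝ} {g : ℝ → ℝ} {g' : ℝ} {p : ℝ × ℝ}
    (hf : ∀ q : ℝ × ℝ, 0 < q.1 + q.2 → f q = g (q.1 + q.2)) (hp : 0 < p.1 + p.2)
    (hg : HasDerivAt g g' (p.1 + p.2)) : pdx f p = g' := by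
  have hev : (fun s => f (p.1, s)) =ᶠ[nhds p.2] fun s => g (p.1 + s) := by
    have hpos : ∀ᶠ s in nhds p.2, 0 < p.1 + s :=
      (continuous_const.add continuous_id).continuousAt.eventually (lt_mem_nhds hp)
    filter_upwards [hpos] with s hs using hf (p.1, s) hs
  exact ((hg.comp_const_add p.1 p.2).congr_of_eventuallyEq hev).deriv

/-- The derivative of `s ↦ c / s` away from zero. -/
theorem hasDerivAt_const_div (c : ℝ) {s : ℝ} (hs : s ≠ 0) :
    HasDerivAt (fun r => c / r) (-c / s ^ 2) s := by
  simp only [div_eq_mul_inv c]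
  exact ((hasDerivAt_inv hs).const_mul c).congr_deriv (by ring)

/-- For the Euler–Poisson equation with parameters P₀, Q₀, the Laplace semi-invariants
and Ovsiannikov invariants are as claimed, and P ≡ P₀, Q ≡ Q₀. -/
theorem invariants_of_euler_poisson_equation
    (P₀ Q₀ : ℝ) (hQ₀ : Q₀ ≠ 0)
    (T X U H K : ℝ × ℝ → ℝ)
    (hT : ∀ p : ℝ × ℝ, 0 < p.1 + p.2 → T p = 2 / (Q₀ * (p.1 + p.2)))
    (hX : ∀ p : ℝ × ℝ, 0 < p.1 + p.2 → X p = 2 * P₀ / (Q₀ * (p.1 + p.2)))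
    (hU : ∀ p : ℝ × ℝ, 0 < p.1 + p.2 → U p = -(4 * P₀) / (Q₀ ^ 2 * (p.1 + p.2) ^ 2))
    (hH : ∀ p : ℝ × ℝ, 0 < p.1 + p.2 → H p = -pdt T p + T p * X p + U p)
    (hK : ∀ p : ℝ × ℝ, 0 < p.1 + p.2 → K p = -pdx X p + T p * X p + U p) :
    ∀ p : ℝ × ℝ, 0 < p.1 + p.2 →
      H p = 2 / (Q₀ * (p.1 + p.2) ^ 2)
      ∧ K p = P₀ * H p
      ∧ pdt (pdx (fun q => Real.log |H q|)) p = Q₀ * H p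
      ∧ K p / H p = P₀
      ∧ pdt (pdx (fun q => Real.log |H q|)) p / H p = Q₀ := by
  have hH' : ∀ p : ℝ × ℝ, 0 < p.1 + p.2 → H p = 2 / (Q₀ * (p.1 + p.2) ^ 2) := by
    intro p hp
    have hd : pdt T p = -(2 / Q₀) / (p.1 + p.2) ^ 2 :=
      pdt_eq_of_hasDerivAt_add (fun q hq => by rw [hT q hq, div_div]) hp
        (hasDerivAt_const_div (2 / Q₀) hp.ne')
    rw [hH p hp, hd, hT p hp, hX p hp, hU p hp]
    have := hp.ne'
    field_simp
    ring
  have hlog_x : ∀ p : ℝ × ℝ, 0 < p.1 + p.2 →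
      pdx (fun q => Real.log |H q|) p = -2 / (p.1 + p.2) := by
    intro p hp
    refine pdx_eq_of_hasDerivAt_add (g := fun s => Real.log (2 / Q₀) - 2 * Real.log s)
      (fun q hq => ?_) hp ?_
    · have hq' := hq.ne'
      rw [hH' q hq, Real.log_abs, ← div_div, Real.log_div (by positivity) (by positivity),
        Real.log_pow]
      norm_num
    · exact (((Real.hasDerivAt_log hp.ne').const_mul 2).const_sub _).congr_deriv (by ring)
  intro p hp
  have hs := hp.ne'
  have hne : H p ≠ 0 := by
    rw [hH' p hp]
    positivity
  have hKH : K p = P₀ * H p := by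
    have hd : pdx X p = -(2 * P₀ / Q₀) / (p.1 + p.2) ^ 2 :=
      pdx_eq_of_hasDerivAt_add (fun q hq => by rw [hX q hq, div_div]) hp
        (hasDerivAt_const_div (2 * P₀ / Q₀) hs)
    rw [hK p hp, hd, hT p hp, hX p hp, hU p hp, hH' p hp]
    field_simp
    ring
  have hlog_tx : pdt (pdx (fun q => Real.log |H q|)) p = Q₀ * H p := by
    rw [pdt_eq_of_hasDerivAt_add hlog_x hp (hasDerivAt_const_div (-2) hs), hH' p hp]
    field_simp
  exact ⟨hH' p hp, hKH, hlog_tx, by rw [hKH, mul_div_cancel_right₀ _ hne],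
    by rw [hlog_tx, mul_div_cancel_right₀ _ hne]⟩
end

section
/- Let I ⊆ ℝ be an open interval and let p, q : ℝ → ℝ be C² and nonvanishing on I. On Ω = {(t,x) : t ∈ I, t + x > 0} define T(t,x) = 1, X(t,x) = 2(p(t)−1)/(q(t)(t+x)), U(t,x) = 2(1 − (p(t)−1)(t+x))/(q(t)(t+x)²) (the coefficients of equation (CE): u_{tx} = u_t + X·u_x + U·u). Then the Laplace semi-invariants satisfy H(t,x) := −T_t + T·X + U = 2/(q(t)(t+x)²) and K(t,x) := −X_x + T·X + U = p(t)·H(t,x) on Ω; moreover ∂²(log|H|)/∂t∂x (t,x) = q(t)·H(t,x). Consequently the Ovsiannikov invariants are P(t,x) = K/H = p(t) and Q(t,x) = ((log|H|)_{tx})/H = q(t). -/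
open Real Set

/-- The partial derivative in the first variable only depends on values on an open set. -/
theorem pdt_eq_of_eqOn {f g : ℝ × ℝ → ℝ} {s : Set (ℝ × ℝ)} (hs : IsOpen s)
    (hfg : EqOn f g s) : EqOn (pdt f) (pdt g) s := by
  intro p hp
  have hmem : ∀ᶠ r in nhds p.1, (r, p.2) ∈ s :=
    (Continuous.prodMk_left p.2).continuousAt.eventually (hs.mem_nhds hp)
  exact Filter.EventuallyEq.deriv_eq (hmem.mono fun r hr => hfg hr)

/-- The partial derivative in the second variable only depends on values on an open set. -/
theorem pdx_eq_of_eqOn {f g : ℝ × ℝ → ℝ} {s : Set (ℝ × ℝ)} (hs : IsOpen s)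
    (hfg : EqOn f g s) : EqOn (pdx f) (pdx g) s := by
  intro p hp
  have hmem : ∀ᶠ r in nhds p.2, (p.1, r) ∈ s :=
    (Continuous.prodMk_right p.1).continuousAt.eventually (hs.mem_nhds hp)
  exact Filter.EventuallyEq.deriv_eq (hmem.mono fun r hr => hfg hr)

theorem hasDerivAt_const_div_add (c a x : ℝ) (h : a + x ≠ 0) :
    HasDerivAt (fun r => c / (a + r)) (-c / (a + x) ^ 2) x := by
  simpa using (hasDerivAt_const x c).fun_div ((hasDerivAt_id' x).const_add a) h

theorem pdx_div_mul_add (a b : ℝ → ℝ) (p : ℝ × ℝ) (h : p.1 + p.2 ≠ 0) :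
    pdx (fun r => a r.1 / (b r.1 * (r.1 + r.2))) p = -(a p.1 / b p.1) / (p.1 + p.2) ^ 2 := by
  simpa only [pdx, div_mul_eq_div_div] using
    (hasDerivAt_const_div_add (a p.1 / b p.1) p.1 p.2 h).deriv

theorem pdx_log_abs_div_mul_sq (c : ℝ) (b : ℝ → ℝ) (p : ℝ × ℝ) (hc : c ≠ 0)
    (hb : b p.1 ≠ 0) (h : p.1 + p.2 ≠ 0) :
    pdx (fun r => Real.log |c / (b r.1 * (r.1 + r.2) ^ 2)|) p = -2 / (p.1 + p.2) := by
  have hden : HasDerivAt (fun r => b p.1 * (p.1 + r) ^ 2) (b p.1 * (2 * (p.1 + p.2))) p.2 := by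
    simpa using (((hasDerivAt_id' p.2).const_add p.1).fun_pow 2).const_mul (b p.1)
  have hne : b p.1 * (p.1 + p.2) ^ 2 ≠ 0 := mul_ne_zero hb (pow_ne_zero 2 h)
  have hlog := ((hasDerivAt_const p.2 c).fun_div hden hne).log (div_ne_zero hc hne)
  simp only [pdx, Real.log_abs]
  rw [hlog.deriv]
  field_simp
  ring

theorem pdt_const_div_add (c : ℝ) (p : ℝ × ℝ) (h : p.1 + p.2 ≠ 0) :
    pdt (fun r => c / (r.1 + r.2)) p = -c / (p.1 + p.2) ^ 2 := by
  simpa only [pdt, add_comm] using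
    (hasDerivAt_const_div_add c p.2 p.1 (by rwa [add_comm])).deriv

/-- For the counterexample equation (CE), the Laplace semi-invariants are
H = 2/(q(t)(t+x)²), K = p(t)·H, and the Ovsiannikov invariants are P = p(t),
Q = q(t). -/
theorem invariants_of_counterexample_equation
    (I : Set ℝ) (hIopen : IsOpen I) (hIconn : I.OrdConnected)
    (pf qf : ℝ → ℝ) (hp : ContDiffOn ℝ 2 pf I) (hq : ContDiffOn ℝ 2 qf I)
    (hpne : ∀ t ∈ I, pf t ≠ 0) (hqne : ∀ t ∈ I, qf t ≠ 0)
    (Ω : Set (ℝ × ℝ)) (hΩ : Ω = {p : ℝ × ℝ | p.1 ∈ I ∧ 0 < p.1 + p.2})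
    (T X U H K : ℝ × ℝ → ℝ)
    (hT : ∀ p ∈ Ω, T p = 1)
    (hX : ∀ p ∈ Ω, X p = 2 * (pf p.1 - 1) / (qf p.1 * (p.1 + p.2)))
    (hU : ∀ p ∈ Ω, U p =
      2 * (1 - (pf p.1 - 1) * (p.1 + p.2)) / (qf p.1 * (p.1 + p.2) ^ 2))
    (hH : ∀ p ∈ Ω, H p = -pdt T p + T p * X p + U p)
    (hK : ∀ p ∈ Ω, K p = -pdx X p + T p * X p + U p) :
    ∀ p ∈ Ω,
      H p = 2 / (qf p.1 * (p.1 + p.2) ^ 2)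
      ∧ K p = pf p.1 * H p
      ∧ pdt (pdx (fun q => Real.log |H q|)) p = qf p.1 * H p
      ∧ K p / H p = pf p.1
      ∧ pdt (pdx (fun q => Real.log |H q|)) p / H p = qf p.1 := by
  have hΩopen : IsOpen Ω := by
    rw [hΩ]
    exact (hIopen.preimage continuous_fst).inter
      (isOpen_lt continuous_const (continuous_fst.add continuous_snd))
  have hsum : ∀ p ∈ Ω, p.1 + p.2 ≠ 0 := by
    rw [hΩ]
    exact fun p hp => hp.2.ne'
  have hqΩ : ∀ p ∈ Ω, qf p.1 ≠ 0 := by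
    rw [hΩ]
    exact fun p hp => hqne p.1 hp.1
  have hHval : ∀ p ∈ Ω, H p = 2 / (qf p.1 * (p.1 + p.2) ^ 2) := by
    intro p hp
    have hTt : pdt T p = 0 := by
      rw [pdt_eq_of_eqOn hΩopen (g := fun _ => 1) hT hp]
      simp [pdt]
    have hs := hsum p hp
    have hq0 := hqΩ p hp
    rw [hH p hp, hTt, hT p hp, hX p hp, hU p hp]
    field_simp
    ring
  have hKval : ∀ p ∈ Ω, K p = pf p.1 * H p := by
    intro p hp
    have hs := hsum p hp
    have hq0 := hqΩ p hp
    rw [hK p hp, hHval p hp, pdx_eq_of_eqOn hΩopen hX hp,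
      pdx_div_mul_add (fun t => 2 * (pf t - 1)) qf p hs, hT p hp, hX p hp, hU p hp]
    field_simp
    ring
  have hlogx : EqOn (pdx fun r => Real.log |H r|) (fun r => -2 / (r.1 + r.2)) Ω := by
    intro p hp
    rw [pdx_eq_of_eqOn hΩopen
      (g := fun r => Real.log |2 / (qf r.1 * (r.1 + r.2) ^ 2)|)
      (fun r hr => by simp only [hHval r hr]) hp]
    exact pdx_log_abs_div_mul_sq 2 qf p two_ne_zero (hqΩ p hp) (hsum p hp)
  have hlogtx : ∀ p ∈ Ω, pdt (pdx fun r => Real.log |H r|) p = qf p.1 * H p := by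
    intro p hp
    have hs := hsum p hp
    have hq0 := hqΩ p hp
    rw [pdt_eq_of_eqOn hΩopen hlogx hp, pdt_const_div_add (-2) p hs, hHval p hp]
    field_simp
  intro p hp
  have hH0 : H p ≠ 0 := by
    rw [hHval p hp]
    exact div_ne_zero two_ne_zero (mul_ne_zero (hqΩ p hp) (pow_ne_zero 2 (hsum p hp)))
  refine ⟨hHval p hp, hKval p hp, hlogtx p hp, ?_, ?_⟩
  · rw [hKval p hp, mul_div_cancel_right₀ _ hH0]
  · rw [hlogtx p hp, mul_div_cancel_right₀ _ hH0]
end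

section
/- Let I ⊆ ℝ be an open interval and let p, q : ℝ → ℝ be C² and nonvanishing on I. On Ω = {(t,x) : t ∈ I, t + x > 0}, let H and K be the Laplace semi-invariants of equation (CE), namely H(t,x) = 2/(q(t)(t+x)²) and K(t,x) = p(t)·H(t,x). Then the invariant J¹₃ := H^(−3)·(K·H_{tx} + H·K_{tx} − H_t·K_x − H_x·K_t) satisfies J¹₃(t,x) = 2·p(t)·q(t) for all (t,x) ∈ Ω. -/
open Real Set

/-- The `x`-derivative of a function which equals `g(t) (t + x) ^ m` for `t ∈ I`, `t + x > 0`. -/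
theorem pdx_of_eq_mul_zpow {I : Set ℝ} {F : ℝ × ℝ → ℝ} {g : ℝ → ℝ} {m : ℤ}
    (hF : ∀ p : ℝ × ℝ, p.1 ∈ I → 0 < p.1 + p.2 → F p = g p.1 * (p.1 + p.2) ^ m)
    (p : ℝ × ℝ) (hpI : p.1 ∈ I) (hpos : 0 < p.1 + p.2) :
    pdx F p = m * g p.1 * (p.1 + p.2) ^ (m - 1) := by
  have hev : (fun s => F (p.1, s)) =ᶠ[nhds p.2] fun s => g p.1 * (p.1 + s) ^ m := by
    have hopen : IsOpen {s : ℝ | 0 < p.1 + s} := isOpen_lt (by fun_prop) (by fun_prop)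
    filter_upwards [hopen.mem_nhds hpos] with s hs using hF (p.1, s) hpI hs
  have hd := (((hasDerivAt_zpow m (p.1 + p.2) (Or.inl hpos.ne')).comp p.2
    ((hasDerivAt_id p.2).const_add p.1)).const_mul (g p.1))
  rw [pdx, hev.deriv_eq]
  exact hd.deriv.trans (by ring)

/-- The `t`-derivative of a function which equals `g(t) (t + x) ^ m` for `t ∈ I`, `t + x > 0`. -/
theorem pdt_of_eq_mul_zpow {I : Set ℝ} (hI : IsOpen I) {F : ℝ × ℝ → ℝ} {g : ℝ → ℝ} {m : ℤ}
    (hF : ∀ p : ℝ × ℝ, p.1 ∈ I → 0 < p.1 + p.2 → F p = g p.1 * (p.1 + p.2) ^ m)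
    (p : ℝ × ℝ) (hpI : p.1 ∈ I) (hpos : 0 < p.1 + p.2) {g' : ℝ} (hg : HasDerivAt g g' p.1) :
    pdt F p = g' * (p.1 + p.2) ^ m + g p.1 * (m * (p.1 + p.2) ^ (m - 1)) := by
  have hev : (fun s => F (s, p.2)) =ᶠ[nhds p.1] fun s => g s * (s + p.2) ^ m := by
    have hopen : IsOpen {s : ℝ | 0 < s + p.2} := isOpen_lt (by fun_prop) (by fun_prop)
    filter_upwards [hI.mem_nhds hpI, hopen.mem_nhds hpos] with s hsI hs using hF (s, p.2) hsI hs
  have hd := hg.mul ((hasDerivAt_zpow m (p.1 + p.2) (Or.inl hpos.ne')).comp p.1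
    ((hasDerivAt_id p.1).add_const p.2))
  rw [pdt, hev.deriv_eq]
  exact hd.deriv.trans (by simp)

/-- For the counterexample equation (CE) the invariant J¹₃ equals 2 p(t) q(t). -/
theorem invariant_J13_of_counterexample_equation
    (I : Set ℝ) (hIopen : IsOpen I) (hIconn : I.OrdConnected)
    (pf qf : ℝ → ℝ) (hp : ContDiffOn ℝ 2 pf I) (hq : ContDiffOn ℝ 2 qf I)
    (hpne : ∀ t ∈ I, pf t ≠ 0) (hqne : ∀ t ∈ I, qf t ≠ 0)
    (Ω : Set (ℝ × ℝ)) (hΩ : Ω = {p : ℝ × ℝ | p.1 ∈ I ∧ 0 < p.1 + p.2})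
    (H K : ℝ × ℝ → ℝ)
    (hH : ∀ p ∈ Ω, H p = 2 / (qf p.1 * (p.1 + p.2) ^ 2))
    (hK : ∀ p ∈ Ω, K p = pf p.1 * H p) :
    ∀ p ∈ Ω,
      (K p * pdt (pdx H) p + H p * pdt (pdx K) p
        - pdt H p * pdx K p - pdx H p * pdt K p) / (H p) ^ 3
      = 2 * pf p.1 * qf p.1 := by
  subst hΩ
  have hH' : ∀ p : ℝ × ℝ, p.1 ∈ I → 0 < p.1 + p.2 →
      H p = 2 / qf p.1 * (p.1 + p.2) ^ (-2 : ℤ) := by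
    intro p hpI hpos
    rw [hH p ⟨hpI, hpos⟩, zpow_neg, ← div_eq_mul_inv, div_div]
    rfl
  have hK' : ∀ p : ℝ × ℝ, p.1 ∈ I → 0 < p.1 + p.2 →
      K p = pf p.1 * (2 / qf p.1) * (p.1 + p.2) ^ (-2 : ℤ) := by
    intro p hpI hpos
    rw [hK p ⟨hpI, hpos⟩, hH' p hpI hpos, mul_assoc]
  rintro ⟨t, x⟩ ⟨hpI, hpos⟩
  have hdp : HasDerivAt pf (deriv pf t) t :=
    ((hp.differentiableOn (by norm_num)).differentiableAt (hIopen.mem_nhds hpI)).hasDerivAt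
  have hdq : DifferentiableAt ℝ qf t :=
    (hq.differentiableOn (by norm_num)).differentiableAt (hIopen.mem_nhds hpI)
  have hqt : qf t ≠ 0 := hqne t hpI
  have hdH : HasDerivAt (fun s => 2 / qf s) (deriv (fun s => 2 / qf s) t) t :=
    ((differentiableAt_const _).div hdq hqt).hasDerivAt
  have hdK := hdp.mul hdH
  have hHx := pdx_of_eq_mul_zpow (g := fun s => 2 / qf s) hH'
  have hKx := pdx_of_eq_mul_zpow (g := fun s => pf s * (2 / qf s)) hK'
  rw [pdt_of_eq_mul_zpow hIopen (g := fun s => ((-2 : ℤ) : ℝ) * (2 / qf s)) hHx (t, x) hpI hpos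
      (hdH.const_mul _),
    pdt_of_eq_mul_zpow hIopen (g := fun s => ((-2 : ℤ) : ℝ) * (pf s * (2 / qf s))) hKx (t, x) hpI
      hpos (hdK.const_mul _),
    pdt_of_eq_mul_zpow hIopen (g := fun s => 2 / qf s) hH' (t, x) hpI hpos hdH,
    pdt_of_eq_mul_zpow hIopen (g := fun s => pf s * (2 / qf s)) hK' (t, x) hpI hpos hdK,
    hHx (t, x) hpI hpos, hKx (t, x) hpI hpos, hH' (t, x) hpI hpos, hK' (t, x) hpI hpos]
  generalize deriv (fun s => 2 / qf s) t = b
  generalize deriv pf t = a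
  have hs : t + x ≠ 0 := ne_of_gt hpos
  have h3 : (-2 - 1 : ℤ) = -3 := by norm_num
  have h4 : (-3 - 1 : ℤ) = -4 := by norm_num
  simp only [h3, h4]
  push_cast
  field_simp
  ring
end

section
/- Let I ⊆ ℝ be an open interval and let p, q : ℝ → ℝ be C² and nonvanishing on I with p′(t) ≠ 0 and q′(t) ≠ 0 for all t ∈ I. On Ω = {(t,x) : t ∈ I, t + x > 0}, let H(t,x) = 2/(q(t)(t+x)²) and K(t,x) = p(t)·H(t,x) be the Laplace semi-invariants of equation (CE), and set P = K/H = p(t), Q = ((log|H|)_{tx})/H = q(t), and J := (H_t·P_t − H·P_{tt})·H^(−1)·P_t^(−2). Then ∂J/∂x (t,x) = 2/(p′(t)·(t+x)²) ≠ 0 on Ω. Consequently, for any nonempty open set Ω′ ⊆ Ω there is no function F : ℝ⁷ → ℝ with J(t,x) = F(P(t,x), Q(t,x), J¹₃(t,x), J²₃(t,x), J³₃(t,x), I₀(t,x), Q̃(t,x)) for all (t,x) ∈ Ω′, where J¹₃ = 2p(t)q(t), J²₃ = 0, J³₃ = 0, I₀ = 0, Q̃ = q(t)/p(t) are the other invariants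 of (CE); i.e. J is functionally independent of them. -/
open Real Set

/-- Functions agreeing on an open set have the same first partial derivative there. -/
theorem Set.EqOn.pdt_eq {f g : ℝ × ℝ → ℝ} {U : Set (ℝ × ℝ)} (hU : IsOpen U) (h : EqOn f g U) :
    EqOn (pdt f) (pdt g) U := by
  intro z hz
  have hc : Continuous fun s : ℝ => (s, z.2) := by fun_prop
  refine Filter.EventuallyEq.deriv_eq ?_
  filter_upwards [(hU.preimage hc).mem_nhds (show z.1 ∈ _ from hz)] with s hs using h hs

/-- Functions agreeing on an open set have the same second partial derivative there. -/
theorem Set.EqOn.pdx_eq {f g : ℝ × ℝ → ℝ} {U : Set (ℝ × ℝ)} (hU : IsOpen U) (h : EqOn f g U) :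
    EqOn (pdx f) (pdx g) U := by
  intro z hz
  have hc : Continuous fun s : ℝ => (z.1, s) := by fun_prop
  refine Filter.EventuallyEq.deriv_eq ?_
  filter_upwards [(hU.preimage hc).mem_nhds (show z.2 ∈ _ from hz)] with s hs using h hs

/-- The `t`-derivative, in logarithmic form, of `2 / (q(t) (t + x)²)`. -/
theorem pdt_semiInvariant {q : ℝ → ℝ} {z : ℝ × ℝ} (hd : DifferentiableAt ℝ q z.1)
    (hq : q z.1 ≠ 0) (hz : z.1 + z.2 ≠ 0) :
    pdt (fun w => 2 / (q w.1 * (w.1 + w.2) ^ 2)) z =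
      2 / (q z.1 * (z.1 + z.2) ^ 2) * (-(deriv q z.1 / q z.1) - 2 / (z.1 + z.2)) := by
  have h := (hasDerivAt_const z.1 (2 : ℝ)).fun_div
    (hd.hasDerivAt.fun_mul (((hasDerivAt_id' z.1).add_const z.2).fun_pow 2))
    (mul_ne_zero hq (pow_ne_zero 2 hz))
  refine h.deriv.trans ?_
  field_simp
  ring

/-- The mixed derivative of `log |2 / (q(t) (t + x)²)|`. -/
theorem pdt_pdx_log_semiInvariant {q : ℝ → ℝ} {U : Set (ℝ × ℝ)} (hU : IsOpen U)
    (hq : ∀ z ∈ U, q z.1 ≠ 0) (hpos : ∀ z ∈ U, 0 < z.1 + z.2) {z : ℝ × ℝ} (hz : z ∈ U) :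
    pdt (pdx fun w => Real.log |2 / (q w.1 * (w.1 + w.2) ^ 2)|) z = 2 / (z.1 + z.2) ^ 2 := by
  have hx : EqOn (pdx fun w => Real.log |2 / (q w.1 * (w.1 + w.2) ^ 2)|)
      (fun w => -2 / (w.1 + w.2)) U := by
    intro w hw
    have hs := (hpos w hw).ne'
    have hqw := hq w hw
    simp only [Real.log_abs]
    have h := ((hasDerivAt_const w.2 (2 : ℝ)).fun_div
      ((((hasDerivAt_id' w.2).const_add w.1).fun_pow 2).const_mul (q w.1))
      (mul_ne_zero hqw (pow_ne_zero 2 hs))).log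
      (div_ne_zero two_ne_zero (mul_ne_zero hqw (pow_ne_zero 2 hs)))
    refine h.deriv.trans ?_
    field_simp
    ring
  have hs := (hpos z hz).ne'
  rw [hx.pdt_eq hU hz]
  have h := (hasDerivAt_const z.1 (-2 : ℝ)).fun_div ((hasDerivAt_id' z.1).add_const z.2) hs
  refine h.deriv.trans ?_
  field_simp
  ring

/-- For the counterexample equation (CE), the invariant J depends explicitly on x
(∂J/∂x = 2/(p'(t)(t+x)²) ≠ 0) and hence is functionally independent of
P, Q, J¹₃, J²₃, J³₃, I₀, Q̃. -/
theorem invariant_J_functionally_independent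
    (I : Set ℝ) (hIopen : IsOpen I) (hIconn : I.OrdConnected)
    (pf qf : ℝ → ℝ) (hp : ContDiffOn ℝ 2 pf I) (hq : ContDiffOn ℝ 2 qf I)
    (hpne : ∀ t ∈ I, pf t ≠ 0) (hqne : ∀ t ∈ I, qf t ≠ 0)
    (hp' : ∀ t ∈ I, deriv pf t ≠ 0) (hq' : ∀ t ∈ I, deriv qf t ≠ 0)
    (Ω : Set (ℝ × ℝ)) (hΩ : Ω = {p : ℝ × ℝ | p.1 ∈ I ∧ 0 < p.1 + p.2})
    (H K P Q J : ℝ × ℝ → ℝ)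
    (hH : ∀ p ∈ Ω, H p = 2 / (qf p.1 * (p.1 + p.2) ^ 2))
    (hK : ∀ p ∈ Ω, K p = pf p.1 * H p)
    (hP : ∀ p : ℝ × ℝ, P p = K p / H p)
    (hQ : ∀ p : ℝ × ℝ, Q p = pdt (pdx (fun q => Real.log |H q|)) p / H p)
    (hJ : ∀ p : ℝ × ℝ, J p =
      (pdt H p * pdt P p - H p * pdt (pdt P) p) * (H p)⁻¹ * (pdt P p)⁻¹ ^ 2) :
    (∀ p ∈ Ω, pdx J p = 2 / (deriv pf p.1 * (p.1 + p.2) ^ 2) ∧ pdx J p ≠ 0)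
    ∧ (∀ Ω' : Set (ℝ × ℝ), Ω' ⊆ Ω → IsOpen Ω' → Ω'.Nonempty →
        ¬ ∃ F : ℝ → ℝ → ℝ → ℝ → ℝ → ℝ → ℝ → ℝ,
          ∀ p ∈ Ω', J p = F (P p) (Q p) (2 * pf p.1 * qf p.1) 0 0 0
            (qf p.1 / pf p.1)) := by
  have hΩopen : IsOpen Ω := by
    rw [hΩ]
    exact (hIopen.preimage continuous_fst).inter
      (isOpen_lt continuous_const (continuous_fst.add continuous_snd))
  have hmem : ∀ z ∈ Ω, z.1 ∈ I ∧ 0 < z.1 + z.2 := fun z hz => by rwa [hΩ] at hz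
  have hHne : ∀ z ∈ Ω, H z ≠ 0 := fun z hz => by
    rw [hH z hz]
    exact div_ne_zero two_ne_zero
      (mul_ne_zero (hqne _ (hmem z hz).1) (pow_ne_zero 2 (hmem z hz).2.ne'))
  have hPΩ : EqOn P (fun z => pf z.1) Ω := fun z hz => by
    rw [hP, hK z hz, mul_div_cancel_right₀ _ (hHne z hz)]
  have hPt : EqOn (pdt P) (fun z => deriv pf z.1) Ω := hPΩ.pdt_eq hΩopen
  have hPtt : EqOn (pdt (pdt P)) (fun z => deriv (deriv pf) z.1) Ω := hPt.pdt_eq hΩopen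
  have hHt : ∀ z ∈ Ω, pdt H z = H z * (-(deriv qf z.1 / qf z.1) - 2 / (z.1 + z.2)) :=
    fun z hz => by
      have hzI := (hmem z hz).1
      rw [EqOn.pdt_eq hΩopen (g := fun w => 2 / (qf w.1 * (w.1 + w.2) ^ 2)) hH hz, hH z hz]
      exact pdt_semiInvariant
        ((hq.differentiableOn two_ne_zero).differentiableAt (hIopen.mem_nhds hzI))
        (hqne _ hzI) (hmem z hz).2.ne'
  have hQΩ : EqOn Q (fun z => qf z.1) Ω := fun z hz => by
    have hlog : EqOn (fun w => Real.log |H w|)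
        (fun w => Real.log |2 / (qf w.1 * (w.1 + w.2) ^ 2)|) Ω := fun w hw => by
      simp only [hH w hw]
    have hqz := hqne _ (hmem z hz).1
    have hs := (hmem z hz).2.ne'
    rw [hQ, (hlog.pdx_eq hΩopen).pdt_eq hΩopen hz, pdt_pdx_log_semiInvariant hΩopen
      (fun w hw => hqne _ (hmem w hw).1) (fun w hw => (hmem w hw).2) hz, hH z hz]
    field_simp
  have hJΩ : EqOn J (fun z => (-(deriv qf z.1 / qf z.1) - 2 / (z.1 + z.2)) / deriv pf z.1
      - deriv (deriv pf) z.1 / deriv pf z.1 ^ 2) Ω := fun z hz => by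
    have hHz := hHne z hz
    have hpz := hp' _ (hmem z hz).1
    rw [hJ, hHt z hz, hPt hz, hPtt hz]
    beta_reduce
    generalize -(deriv qf z.1 / qf z.1) - 2 / (z.1 + z.2) = a
    field_simp
  have hJx : ∀ z ∈ Ω, pdx J z = 2 / (deriv pf z.1 * (z.1 + z.2) ^ 2) := fun z hz => by
    have hs := (hmem z hz).2.ne'
    have hpz := hp' _ (hmem z hz).1
    rw [hJΩ.pdx_eq hΩopen hz]
    have h := ((((hasDerivAt_const z.2 (2 : ℝ)).fun_div
      ((hasDerivAt_id' z.2).const_add z.1) hs).const_sub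
        (-(deriv qf z.1 / qf z.1))).div_const (deriv pf z.1)).sub_const
          (deriv (deriv pf) z.1 / deriv pf z.1 ^ 2)
    refine h.deriv.trans ?_
    field_simp
    ring
  have hJx_ne : ∀ z ∈ Ω, pdx J z ≠ 0 := fun z hz => by
    rw [hJx z hz]
    exact div_ne_zero two_ne_zero
      (mul_ne_zero (hp' _ (hmem z hz).1) (pow_ne_zero 2 (hmem z hz).2.ne'))
  refine ⟨fun z hz => ⟨hJx z hz, hJx_ne z hz⟩, ?_⟩
  rintro Ω' hsub hopen ⟨z, hz⟩ ⟨F, hF⟩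
  refine hJx_ne z (hsub hz) ?_
  have hJF : EqOn J (fun w => F (pf w.1) (qf w.1) (2 * pf w.1 * qf w.1) 0 0 0
      (qf w.1 / pf w.1)) Ω' := fun w hw => by
    rw [hF w hw, hPΩ (hsub hw), hQΩ (hsub hw)]
  rw [hJF.pdx_eq hopen hz]
  exact deriv_const z.2 (F (pf z.1) (qf z.1) (2 * pf z.1 * qf z.1) 0 0 0 (qf z.1 / pf z.1))
end
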